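/- Uniform structure on a Lorentzian pre-length space. Let (X, ℓ) be a Lorentzian pre-length space whose time separation τ = max(0, ℓ) is finite-valued, and let ∅ ≠ S ⊆ X. Then the sets V^s_δ := {(y,z) ∈ X × X : |ℓ(y,s) − ℓ(z,s)| < δ and |ℓ(s,y) − ℓ(s,z)| < δ} for s ∈ S and δ > 0 (where differences of values in {−∞} ∪ [0,∞) are computed with the convention (−∞) − (−∞) = 0 and |(−∞) − a| = |a − (−∞)| = +∞ for a ∈ ℝ) form a subbase of entourages generating a uniform structure 𝔘_S on X. If S is countable, then 𝔘_S is pseudo-metrizable; if in addition S has the point distinction property (for all x ≠ y in X there exists s ∈ S with ℓ(x,s) ≠ ℓ(y,s) or ℓ(s,x) ≠ ℓ(s,y)), then 𝔘_S is metrizable. -/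

import Mathlib

open Filter Topology Set

set_option linter.unusedVariables false

universe u v w

noncomputable section

/-- The time separation function `τ = max(0, ℓ)`. -/
def lorTau {X : Type u} (ℓ : X → X → EReal) (x y : X) : EReal := max 0 (ℓ x y)

/-- The chronological relation `x ≪ y`. -/
def chron {X : Type u} (ℓ : X → X → EReal) (x y : X) : Prop := 0 < ℓ x y

/-- The causal relation `x ≤ y`. -/
def causal {X : Type u} (ℓ : X → X → EReal) (x y : X) : Prop := 0 ≤ ℓ x y

/-- The causal diamond `J(p,q)`. -/
def diamondJ {X : Type u} (ℓ : X → X → EReal) (p q : X) : Set X :=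
  {z | causal ℓ p z ∧ causal ℓ z q}

/-- The chronological diamond `I(p,q)`. -/
def diamondI {X : Type u} (ℓ : X → X → EReal) (p q : X) : Set X :=
  {z | chron ℓ p z ∧ chron ℓ z q}

/-- A Lorentzian pre-length space structure on a topological space `(X, tX)`:
`ℓ` takes values in `{−∞} ∪ [0,∞]`, satisfies the reverse triangle inequality (with the
convention `−∞ + ∞ = ∞ + (−∞) = −∞`, which is definitional for `EReal`), `ℓ(x,x) ≥ 0`,
and the topology is finer than the chronological one. -/
structure IsLPLS {X : Type u} (tX : TopologicalSpace X) (ℓ : X → X → EReal) : Prop where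
  bot_or_nonneg : ∀ x y, ℓ x y = ⊥ ∨ 0 ≤ ℓ x y
  revTriangle : ∀ x y z, ℓ x y + ℓ y z ≤ ℓ x z
  refl_nonneg : ∀ x, 0 ≤ ℓ x x
  open_Iplus : ∀ x, @IsOpen X tX {y | chron ℓ x y}
  open_Iminus : ∀ x, @IsOpen X tX {y | chron ℓ y x}

/-- Forward completeness: every monotone increasing and bounded sequence converges. -/
def ForwardComplete {X : Type u} (tX : TopologicalSpace X) (ℓ : X → X → EReal) : Prop :=
  ∀ (x : ℕ → X) (xhat : X), (∀ k, causal ℓ (x k) (x (k + 1))) → (∀ k, causal ℓ (x k) xhat) →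
    ∃ y, Tendsto x atTop (@nhds X tX y)

/-- `(Y, tY, ρ)` together with the map `ι : X → Y` is a forward completion of
`(X, tX, ℓ)`: it is a forward complete Lorentzian pre-length space, all causal futures
and pasts are closed, `ι` is `ℓ`-preserving and `X` is forward dense in `Y`. -/
structure IsForwardCompletion {X : Type u} (tX : TopologicalSpace X) (ℓ : X → X → EReal)
    {Y : Type v} (tY : TopologicalSpace Y) (ρ : Y → Y → EReal) (ι : X → Y) : Prop where
  lpls : IsLPLS tY ρ
  fwdComplete : ForwardComplete tY ρ
  closed_Jplus : ∀ y : Y, @IsClosed Y tY {z | causal ρ y z}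
  closed_Jminus : ∀ y : Y, @IsClosed Y tY {z | causal ρ z y}
  isometric : ∀ x x' : X, ρ (ι x) (ι x') = ℓ x x'
  fwdDense : ∀ y : Y, ∃ u : ℕ → X,
    (∀ k, causal ρ (ι (u k)) (ι (u (k + 1)))) ∧ (∀ k, causal ρ (ι (u k)) y) ∧
    Tendsto (fun k => ι (u k)) atTop (@nhds Y tY y)


/-- `|a - b|` with the conventions `(−∞) − (−∞) = 0` (and `⊤ − ⊤ = 0`) and
`|(−∞) − a| = |a − (−∞)| = +∞` for finite `a`. -/
def lorDiff (a b : EReal) : EReal :=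
  if a = b then 0
  else if a = ⊥ ∨ b = ⊥ ∨ a = ⊤ ∨ b = ⊤ then ⊤
  else ((|a.toReal - b.toReal| : ℝ) : EReal)

/-- The basic entourage `V^s_δ` associated to a point `s` and `δ > 0`. -/
def entV {X : Type u} (ℓ : X → X → EReal) (s : X) (δ : ℝ) : Set (X × X) :=
  {p | lorDiff (ℓ p.1 s) (ℓ p.2 s) < (δ : EReal) ∧
       lorDiff (ℓ s p.1) (ℓ s p.2) < (δ : EReal)}

theorem lorDiff_lt_coe_iff {a b : EReal} {δ : ℝ} (hδ : 0 < δ) :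
    lorDiff a b < (δ : EReal) ↔ a = b ∨ ∃ x y : ℝ, a = x ∧ b = y ∧ |x - y| < δ := by
  have hδ' : (0 : EReal) < δ := EReal.coe_pos.2 hδ
  unfold lorDiff
  split_ifs with h₁ h₂
  · simp [h₁, hδ']
  · simp only [not_top_lt, false_iff, not_or, not_exists]
    refine ⟨h₁, ?_⟩
    rintro x y ⟨rfl, rfl, -⟩
    simp at h₂
  · simp only [not_or] at h₂
    lift a to ℝ using ⟨h₂.2.2.1, h₂.1⟩
    lift b to ℝ using ⟨h₂.2.2.2, h₂.2.1⟩
    simp only [EReal.toReal_coe, EReal.coe_lt_coe_iff]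
    constructor
    · exact fun h => Or.inr ⟨a, b, rfl, rfl, h⟩
    · rintro (h | ⟨x, y, hx, hy, h⟩)
      · exact absurd h h₁
      · rwa [EReal.coe_injective hx, EReal.coe_injective hy]

theorem lorDiff_self_lt_coe (a : EReal) {δ : ℝ} (hδ : 0 < δ) : lorDiff a a < (δ : EReal) :=
  (lorDiff_lt_coe_iff hδ).2 (Or.inl rfl)

theorem lorDiff_comm (a b : EReal) : lorDiff a b = lorDiff b a := by
  unfold lorDiff
  rw [abs_sub_comm]
  grind

theorem lorDiff_lt_coe_add {a b c : EReal} {δ ε : ℝ} (hδ : 0 < δ) (hε : 0 < ε)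
    (hab : lorDiff a b < (δ : EReal)) (hbc : lorDiff b c < (ε : EReal)) :
    lorDiff a c < ((δ + ε : ℝ) : EReal) := by
  rw [lorDiff_lt_coe_iff (by positivity)]
  rcases (lorDiff_lt_coe_iff hδ).1 hab with rfl | ⟨x, y, rfl, rfl, hxy⟩ <;>
    rcases (lorDiff_lt_coe_iff hε).1 hbc with rfl | ⟨y', z, hy, rfl, hyz⟩
  · exact Or.inl rfl
  · exact Or.inr ⟨y', z, hy, rfl, by linarith⟩
  · exact Or.inr ⟨x, y, rfl, rfl, by linarith⟩
  · obtain rfl := EReal.coe_injective hy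
    exact Or.inr ⟨x, z, rfl, rfl, by linarith [abs_sub_le x y z]⟩

theorem eq_of_forall_lorDiff_lt {a b : EReal}
    (h : ∀ δ : ℝ, 0 < δ → lorDiff a b < (δ : EReal)) : a = b := by
  rcases (lorDiff_lt_coe_iff one_pos).1 (h 1 one_pos) with hab | ⟨x, y, rfl, rfl, -⟩
  · exact hab
  by_contra hne
  have hxy : 0 < |x - y| := abs_pos.2 (sub_ne_zero.2 fun e => hne (by rw [e]))
  rcases (lorDiff_lt_coe_iff hxy).1 (h _ hxy) with hab | ⟨x', y', hx, hy, hlt⟩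
  · exact hne hab
  · rw [EReal.coe_injective hx, EReal.coe_injective hy] at hlt
    exact lt_irrefl _ hlt

theorem entV_mono {X : Type u} (ℓ : X → X → EReal) (s : X) {δ ε : ℝ} (h : δ ≤ ε) :
    entV ℓ s δ ⊆ entV ℓ s ε := fun _ hp =>
  ⟨hp.1.trans_le (EReal.coe_le_coe_iff.2 h), hp.2.trans_le (EReal.coe_le_coe_iff.2 h)⟩

/-- The subbase of entourages `V^s_δ` with `s ∈ S` and `δ > 0`. -/
def entSubbase {X : Type u} (ℓ : X → X → EReal) (S : Set X) : Set (Set (X × X)) :=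
  {V | ∃ s ∈ S, ∃ δ : ℝ, 0 < δ ∧ V = entV ℓ s δ}

theorem entV_mem_generate {X : Type u} (ℓ : X → X → EReal) {S : Set X} {s : X} (hs : s ∈ S)
    {δ : ℝ} (hδ : 0 < δ) : entV ℓ s δ ∈ Filter.generate (entSubbase ℓ S) :=
  Filter.mem_generate_of_mem ⟨s, hs, δ, hδ, rfl⟩

/-- The uniform structure generated by the entourages `V^s_δ` with `s ∈ S`. -/
@[reducible]
def entUniformSpace {X : Type u} (ℓ : X → X → EReal) (S : Set X) : UniformSpace X :=
  .ofCore
    { uniformity := Filter.generate (entSubbase ℓ S)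
      refl := by
        rw [Filter.le_generate_iff]
        rintro _ ⟨s, -, δ, hδ, rfl⟩ ⟨x, y⟩ (rfl : x = y)
        exact ⟨lorDiff_self_lt_coe _ hδ, lorDiff_self_lt_coe _ hδ⟩
      symm := by
        rw [Filter.tendsto_iff_comap, ← Filter.map_le_iff_le_comap, Filter.le_generate_iff]
        rintro _ ⟨s, hs, δ, hδ, rfl⟩
        refine Filter.mem_map.2
          (Filter.mem_of_superset (entV_mem_generate ℓ hs hδ) fun p hp => ?_)
        exact ⟨(lorDiff_comm _ _).trans_lt hp.1, (lorDiff_comm _ _).trans_lt hp.2⟩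
      comp := by
        rw [Filter.le_generate_iff]
        rintro _ ⟨s, hs, δ, hδ, rfl⟩
        refine Filter.mem_of_superset
          (Filter.mem_lift' (entV_mem_generate ℓ hs (half_pos hδ))) ?_
        rintro ⟨x, z⟩ ⟨y, hxy, hyz⟩
        have := half_pos hδ
        refine ⟨?_, ?_⟩
        · simpa using lorDiff_lt_coe_add this this hxy.1 hyz.1
        · simpa using lorDiff_lt_coe_add this this hxy.2 hyz.2 }

theorem isCountablyGenerated_generate_entSubbase {X : Type u} (ℓ : X → X → EReal) {S : Set X}
    (hS : S.Countable) : (Filter.generate (entSubbase ℓ S)).IsCountablyGenerated := by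
  refine ⟨(fun p : X × ℕ => entV ℓ p.1 (1 / (p.2 + 1))) '' (S ×ˢ univ),
    (hS.prod countable_univ).image _, le_antisymm ?_ ?_⟩
  · rw [Filter.le_generate_iff]
    rintro _ ⟨⟨s, n⟩, ⟨hs, -⟩, rfl⟩
    exact entV_mem_generate ℓ hs Nat.one_div_pos_of_nat
  · rw [Filter.le_generate_iff]
    rintro _ ⟨s, hs, δ, hδ, rfl⟩
    obtain ⟨n, hn⟩ := exists_nat_one_div_lt hδ
    exact Filter.mem_of_superset
      (Filter.mem_generate_of_mem ⟨(s, n), ⟨hs, mem_univ n⟩, rfl⟩) (entV_mono ℓ s hn.le)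

theorem t0Space_entUniformSpace {X : Type u} (ℓ : X → X → EReal) {S : Set X}
    (hS : ∀ x y : X, x ≠ y → ∃ s ∈ S, ℓ x s ≠ ℓ y s ∨ ℓ s x ≠ ℓ s y) :
    @T0Space X (entUniformSpace ℓ S).toTopologicalSpace := by
  let _ := entUniformSpace ℓ S
  rw [t0Space_iff_uniformity]
  intro x y hxy
  by_contra hne
  obtain ⟨s, hs, h⟩ := hS x y hne
  have key : ∀ δ : ℝ, 0 < δ → (x, y) ∈ entV ℓ s δ := fun δ hδ =>
    hxy _ (entV_mem_generate ℓ hs hδ)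
  rcases h with h | h
  · exact h (eq_of_forall_lorDiff_lt fun δ hδ => (key δ hδ).1)
  · exact h (eq_of_forall_lorDiff_lt fun δ hδ => (key δ hδ).2)

/-- **Uniform structure on a Lorentzian pre-length space** (Lemma A.3).
Let `(X, ℓ)` be a Lorentzian pre-length space with finite-valued time separation and let
`S ⊆ X` be nonempty.  Then the sets `V^s_δ` (`s ∈ S`, `δ > 0`) form a subbase of
entourages generating a uniform structure `𝔘_S` on `X`.  If `S` is countable then `𝔘_S`
is pseudo-metrizable, and if in addition `S` has the point distinction property then
`𝔘_S` is metrizable. -/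
theorem uniform_structure_on_lpls {X : Type u} (tX : TopologicalSpace X)
    (ℓ : X → X → EReal) (h : IsLPLS tX ℓ)
    (hfin : ∀ x y : X, ℓ x y ≠ ⊤)
    (S : Set X) (hS : S.Nonempty) :
    ∃ U : UniformSpace X,
      @uniformity X U =
        Filter.generate {V | ∃ s ∈ S, ∃ δ : ℝ, 0 < δ ∧ V = entV ℓ s δ} ∧
      (S.Countable → ∃ m : PseudoMetricSpace X, m.toUniformSpace = U) ∧
      (S.Countable →
        (∀ x y : X, x ≠ y → ∃ s ∈ S, ℓ x s ≠ ℓ y s ∨ ℓ s x ≠ ℓ s y) →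
        ∃ m : MetricSpace X, m.toUniformSpace = U) := by
  refine ⟨entUniformSpace ℓ S, rfl, fun hc => ?_, fun hc hd => ?_⟩
  · let _ := entUniformSpace ℓ S
    have : (uniformity X).IsCountablyGenerated := isCountablyGenerated_generate_entSubbase ℓ hc
    exact ⟨UniformSpace.pseudoMetricSpace X, rfl⟩
  · let _ := entUniformSpace ℓ S
    have : (uniformity X).IsCountablyGenerated := isCountablyGenerated_generate_entSubbase ℓ hc
    have := t0Space_entUniformSpace ℓ hd
    exact ⟨@UniformSpace.metricSpace X (entUniformSpace ℓ S) _ this, rfl⟩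

end
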